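/- Fix λ > 0 and let g_n^λ denote the Gegenbauer polynomials. Then the Gegenbauer polynomials are orthogonal on [−1,1] with respect to the weight (1−x²)^{λ−1/2}: for all i ≠ j, ∫_{−1}^{1} (1−x²)^{λ−1/2} g_i^λ(x) g_j^λ(x) dx = 0, and for every i, ∫_{−1}^{1} (1−x²)^{λ−1/2} (g_i^λ(x))² dx > 0. -/

import Mathlib

/-- The Gegenbauer polynomials `g_n^λ`, defined by the recurrence
`g_0 = 1`, `g_1 = 2λx`, `g_n = (2(n+λ-1)/n) x g_{n-1} - ((n+2λ-2)/n) g_{n-2}` for `n ≥ 2`. -/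
noncomputable def gegenbauer (l : ℝ) : ℕ → Polynomial ℝ
  | 0 => 1
  | 1 => Polynomial.C (2 * l) * Polynomial.X
  | (n + 2) =>
      Polynomial.C (2 * (((n : ℝ) + 2) + l - 1) / ((n : ℝ) + 2)) * Polynomial.X *
          gegenbauer l (n + 1)
        - Polynomial.C ((((n : ℝ) + 2) + 2 * l - 2) / ((n : ℝ) + 2)) * gegenbauer l n

open Polynomial in
/-- The defining recurrence, cleared of denominators. -/
theorem gegenbauer_add_two (l : ℝ) (n : ℕ) :
    ((n : ℝ[X]) + 2) * gegenbauer l (n + 2) =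
      2 * ((n : ℝ[X]) + 1 + C l) * X * gegenbauer l (n + 1)
        - ((n : ℝ[X]) + 2 * C l) * gegenbauer l n := by
  have hn : (n : ℝ) + 2 ≠ 0 := by positivity
  have hC : ∀ a : ℝ, ((n : ℝ[X]) + 2) * C (a / ((n : ℝ) + 2)) = C a := by
    intro a
    have h : ((n : ℝ[X]) + 2) = C ((n : ℝ) + 2) := by simp [C_ofNat]
    rw [h, ← C_mul, mul_div_cancel₀ a hn]
  have h₁ := hC (2 * (((n : ℝ) + 2) + l - 1))
  have h₂ := hC (((n : ℝ) + 2) + 2 * l - 2)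
  simp only [C_mul, C_add, C_sub, C_1, C_ofNat, map_natCast] at h₁ h₂
  rw [gegenbauer]
  linear_combination X * gegenbauer l (n + 1) * h₁ - gegenbauer l n * h₂

open Polynomial in
theorem gegenbauer_derivative_relations (l : ℝ) (n : ℕ) :
    ((n : ℝ[X]) + 1) * gegenbauer l (n + 1) =
        X * derivative (gegenbauer l (n + 1)) - derivative (gegenbauer l n) ∧
      ((n : ℝ[X]) + 2 * C l) * gegenbauer l n =
        derivative (gegenbauer l (n + 1)) - X * derivative (gegenbauer l n) := by
  induction n with
  | zero =>
    simp only [gegenbauer]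
    constructor
    · simp [mul_comm]
    · simp [C_ofNat]
  | succ n ih =>
    obtain ⟨h₁, h₂⟩ := ih
    have hn : ((n : ℝ[X]) + 2) ≠ 0 := by exact_mod_cast (Nat.succ_ne_zero (n + 1))
    have hr := gegenbauer_add_two l n
    have hd := congrArg derivative hr
    simp only [derivative_mul, derivative_add, derivative_sub, derivative_natCast,
      derivative_ofNat, derivative_one, derivative_C, derivative_X] at hd
    have h₃ : ((n : ℝ[X]) + 1 + 2 * C l) * gegenbauer l (n + 1) =
        derivative (gegenbauer l (n + 2)) - X * derivative (gegenbauer l (n + 1)) := by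
      apply mul_left_cancel₀ hn
      linear_combination -hd + ((n : ℝ[X]) + 2 * C l) * h₁
    push_cast
    refine ⟨?_, h₃⟩
    linear_combination hr + X * h₃ - h₂ + X * h₁

open Polynomial in
theorem gegenbauer_structure_relation (l : ℝ) (n : ℕ) :
    (1 - X ^ 2) * derivative (gegenbauer l (n + 1)) =
      ((n : ℝ[X]) + 2 * C l) * gegenbauer l n
        - ((n : ℝ[X]) + 1) * X * gegenbauer l (n + 1) := by
  obtain ⟨h₁, h₂⟩ := gegenbauer_derivative_relations l n
  linear_combination -h₂ + X * h₁

open Polynomial in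
/-- The Gegenbauer differential equation. -/
theorem gegenbauer_ode (l : ℝ) (n : ℕ) :
    (1 - X ^ 2) * derivative (derivative (gegenbauer l n)) =
      (2 * C l + 1) * X * derivative (gegenbauer l n)
        - (n : ℝ[X]) * ((n : ℝ[X]) + 2 * C l) * gegenbauer l n := by
  cases n with
  | zero => simp [gegenbauer]
  | succ n =>
    have h₁ := (gegenbauer_derivative_relations l n).1
    have hd := congrArg derivative (gegenbauer_structure_relation l n)
    simp only [derivative_mul, derivative_add, derivative_sub, derivative_natCast,
      derivative_ofNat, derivative_one, derivative_C, derivative_X, derivative_X_sq] at hd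
    push_cast
    simp only [C_ofNat] at hd
    linear_combination hd + ((n : ℝ[X]) + 2 * C l) * h₁

theorem gegenbauer_eval_one_pos (l : ℝ) (hl : 0 < l) (n : ℕ) :
    0 < (gegenbauer l n).eval 1 := by
  induction n with
  | zero => simp [gegenbauer]
  | succ n ih =>
    have h := congrArg (Polynomial.eval 1) (gegenbauer_structure_relation l n)
    simp only [Polynomial.eval_mul, Polynomial.eval_sub, Polynomial.eval_add, Polynomial.eval_pow,
      Polynomial.eval_X, Polynomial.eval_C, Polynomial.eval_one, Polynomial.eval_natCast,
      Polynomial.eval_ofNat] at h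
    have h₁ : 0 < ((n : ℝ) + 2 * l) * (gegenbauer l n).eval 1 := by positivity
    have h₂ : 0 < ((n : ℝ) + 1) * (gegenbauer l (n + 1)).eval 1 := by linarith
    exact pos_of_mul_pos_right h₂ (by positivity)

open Set MeasureTheory

theorem intervalIntegrable_one_sub_sq_rpow {r : ℝ} (hr : -1 < r) :
    IntervalIntegrable (fun x : ℝ => (1 - x ^ 2) ^ r) volume (-1) 1 := by
  have hleft : IntervalIntegrable (fun x : ℝ => (1 - x ^ 2) ^ r) volume (-1) 0 := by
    have h : IntervalIntegrable (fun x : ℝ => (x + 1) ^ r) volume (-1) 0 := by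
      simpa using (intervalIntegral.intervalIntegrable_rpow' (a := 0) (b := 1) hr).comp_add_right 1
    have hc : ContinuousOn (fun x : ℝ => (1 - x) ^ r) (uIcc (-1) 0) := by
      intro x hx
      rw [uIcc_of_le (by norm_num)] at hx
      have hpos : 0 < 1 - x := by linarith [hx.2]
      exact ((by fun_prop : ContinuousAt (fun x : ℝ => 1 - x) x).rpow_const
        (Or.inl hpos.ne')).continuousWithinAt
    refine (h.mul_continuousOn hc).congr fun x hx => ?_
    rw [uIoc_of_le (by norm_num)] at hx
    rw [← Real.mul_rpow (by linarith [hx.1]) (by linarith [hx.2])]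
    ring_nf
  have hright : IntervalIntegrable (fun x : ℝ => (1 - x ^ 2) ^ r) volume 0 1 := by
    simpa using (hleft.comp_sub_left 0).symm
  exact hleft.trans hright

theorem intervalIntegrable_weight_mul_eval {r : ℝ} (hr : -1 < r) (p : Polynomial ℝ) :
    IntervalIntegrable (fun x : ℝ => (1 - x ^ 2) ^ r * p.eval x) volume (-1) 1 :=
  (intervalIntegrable_one_sub_sq_rpow hr).mul_continuousOn p.continuous.continuousOn

theorem hasDerivAt_weighted_wronskian (l : ℝ) (p q : Polynomial ℝ) {x : ℝ}
    (hx : x ∈ Ioo (-1 : ℝ) 1) :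
    HasDerivAt
      (fun x : ℝ => (1 - x ^ 2) ^ (l + 1 / 2) *
        (p.derivative * q - p * q.derivative).eval x)
      ((1 - x ^ 2) ^ (l - 1 / 2) *
        ((1 - Polynomial.X ^ 2) * (p.derivative.derivative * q - p * q.derivative.derivative)
          - (2 * Polynomial.C l + 1) * Polynomial.X *
            (p.derivative * q - p * q.derivative)).eval x) x := by
  have hpos : 0 < 1 - x ^ 2 := by nlinarith [hx.1, hx.2]
  have hb : HasDerivAt (fun x : ℝ => 1 - x ^ 2) (-(2 * x)) x := by
    simpa using (hasDerivAt_pow 2 x).const_sub 1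
  have hw := hb.rpow_const (p := l + 1 / 2) (Or.inl hpos.ne')
  have h := hw.mul ((p.derivative * q - p * q.derivative).hasDerivAt x)
  refine h.congr_deriv ?_
  have h₁ : (1 - x ^ 2) ^ (l + 1 / 2) = (1 - x ^ 2) ^ (l - 1 / 2) * (1 - x ^ 2) := by
    rw [← Real.rpow_add_one hpos.ne']
    ring_nf
  have h₂ : l + 1 / 2 - 1 = l - 1 / 2 := by ring
  rw [h₁, h₂]
  simp
  ring

theorem integral_weight_mul_gegenbauer_mul_gegenbauer (l : ℝ) (hl : 0 < l) {i j : ℕ}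
    (hij : i ≠ j) :
    ∫ x in (-1 : ℝ)..1, (1 - x ^ 2) ^ (l - 1 / 2) *
      ((gegenbauer l i).eval x * (gegenbauer l j).eval x) = 0 := by
  set p := gegenbauer l i
  set q := gegenbauer l j
  have hr : -1 < l - 1 / 2 := by linarith
  have hcont : Continuous (fun x : ℝ => (1 - x ^ 2) ^ (l + 1 / 2) *
      (p.derivative * q - p * q.derivative).eval x) :=
    ((by fun_prop : Continuous fun x : ℝ => 1 - x ^ 2).rpow_const
      fun _ => Or.inr (by linarith)).mul (Polynomial.continuous _)
  have hftc := intervalIntegral.integral_eq_sub_of_hasDerivAt_of_le (by norm_num)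
    hcont.continuousOn (fun x hx => hasDerivAt_weighted_wronskian l p q hx)
    (intervalIntegrable_weight_mul_eval hr _)
  have hzero : (0 : ℝ) ^ (l + 1 / 2) = 0 := Real.zero_rpow (by linarith)
  have hpoly : (1 - Polynomial.X ^ 2) *
        (p.derivative.derivative * q - p * q.derivative.derivative)
        - (2 * Polynomial.C l + 1) * Polynomial.X * (p.derivative * q - p * q.derivative) =
      Polynomial.C (((j : ℝ) - i) * (i + j + 2 * l)) * (p * q) := by
    simp only [map_mul, map_sub, map_add, map_natCast, map_ofNat]
    linear_combination q * gegenbauer_ode l i - p * gegenbauer_ode l j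
  have hfactor : ((j : ℝ) - i) * (i + j + 2 * l) ≠ 0 :=
    mul_ne_zero (sub_ne_zero.2 (by exact_mod_cast hij.symm)) (by positivity)
  rw [hpoly] at hftc
  simp only [Polynomial.eval_mul, Polynomial.eval_C, mul_left_comm _ (((j : ℝ) - i) * _),
    intervalIntegral.integral_const_mul] at hftc
  refine (mul_eq_zero.1 (hftc.trans ?_)).resolve_left hfactor
  norm_num [hzero]

theorem integral_weight_mul_eval_sq_pos {r : ℝ} (hr : -1 < r) {p : Polynomial ℝ} (hp : p ≠ 0) :
    0 < ∫ x in (-1 : ℝ)..1, (1 - x ^ 2) ^ r * (p.eval x) ^ 2 := by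
  have hint := intervalIntegrable_weight_mul_eval hr (p ^ 2)
  simp only [Polynomial.eval_pow] at hint
  have hbase : ∀ x ∈ Ioc (-1 : ℝ) 1, 0 ≤ 1 - x ^ 2 := fun x hx => by nlinarith [hx.1, hx.2]
  rw [intervalIntegral.integral_pos_iff_support_of_nonneg_ae' _ hint]
  · refine ⟨by norm_num, ?_⟩
    have hsub : Ioo (-1 : ℝ) 1 \ {x | p.IsRoot x} ⊆
        Function.support (fun x : ℝ => (1 - x ^ 2) ^ r * (p.eval x) ^ 2) ∩ Ioc (-1) 1 := by
      rintro x ⟨hx, hroot⟩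
      have hpos : 0 < 1 - x ^ 2 := by nlinarith [hx.1, hx.2]
      exact ⟨mul_ne_zero (Real.rpow_pos_of_pos hpos r).ne' (pow_ne_zero 2 hroot),
        Ioo_subset_Ioc_self hx⟩
    refine lt_of_lt_of_le ?_ (measure_mono hsub)
    rw [measure_sdiff_null ((Polynomial.finite_setOfPred_isRoot hp).measure_zero _)]
    simp
  · rw [uIoc_of_le (by norm_num)]
    exact (ae_restrict_iff' measurableSet_Ioc).2 (Filter.Eventually.of_forall fun x hx =>
      mul_nonneg (Real.rpow_nonneg (hbase x hx) r) (sq_nonneg _))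

/-- Orthogonality of the Gegenbauer polynomials on `[-1,1]` with respect to the weight
`(1-x²)^{λ-1/2}`: distinct Gegenbauer polynomials are orthogonal, and each has strictly
positive weighted squared norm. -/
theorem gegenbauer_orthogonal (l : ℝ) (hl : 0 < l) :
    (∀ i j : ℕ, i ≠ j →
        ∫ x in (-1 : ℝ)..1,
          Real.rpow (1 - x ^ 2) (l - 1 / 2) *
            ((gegenbauer l i).eval x * (gegenbauer l j).eval x) = 0) ∧
      (∀ i : ℕ,
        0 < ∫ x in (-1 : ℝ)..1,
          Real.rpow (1 - x ^ 2) (l - 1 / 2) * ((gegenbauer l i).eval x) ^ 2) := by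
  simp only [Real.rpow_eq_pow]
  refine ⟨fun i j hij => integral_weight_mul_gegenbauer_mul_gegenbauer l hl hij, fun i =>
    integral_weight_mul_eval_sq_pos (by linarith) fun h => ?_⟩
  simpa [h] using gegenbauer_eval_one_pos l hl i
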